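/- arXiv:1509.06962 — 8 statements merged into one kernel-verified Lean document; each statement's English description precedes it below -/
import Mathlib

section
/- Let G=(V,E,ρ) be a complete multi-valued regulatory graph. Then the map T_G defines a bijection between the set C_G of canonical parametrizations of G and the set T_ρ of all asynchronous transition systems generated by regulatory graphs sharing ρ, i.e., T_G is injective on C_G and {T_G(C) | C ∈ C_G} = T_ρ. -/
/-!
Formalization of multi-valued regulatory graphs (Thomas networks),
their parametrizations, asynchronous transition systems,
canonization, completion, normalization and minimization.
-/

namespace MVReg

open Classical

/-- A multi-valued regulatory graph over components `V` with maximal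
activity levels `ρ`: a finite set of regulations `(u, n, v)` with
threshold `0 < n ≤ ρ u`. -/
structure RegGraph (V : Type*) (ρ : V → ℕ) where
  E : Finset (V × ℕ × V)
  valid : ∀ e ∈ E, 1 ≤ e.2.1 ∧ e.2.1 ≤ ρ e.1

/-- A (total) parametrization candidate: a value for each component and
each potential regulatory context (a context assigns to each regulator
an interval, represented by its pair of endpoints `[j, k)`). -/
abbrev Param (V : Type*) := V → (V → ℕ × ℕ) → ℕ

variable {V : Type*} [DecidableEq V] [Fintype V] {ρ : V → ℕ}

/-- The extended threshold set `Θ(u,v) = θ(u,v) ∪ {0, ρ u + 1}`. -/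
def Theta (G : RegGraph V ρ) (u v : V) : Set ℕ :=
  {m | (u, m, v) ∈ G.E} ∪ {0, ρ u + 1}

/-- Activity intervals `I_v^u`: pairs `(j,k)` (representing `[j,k)`) of
consecutive members of `Θ(u,v)`. -/
def ActInterval (G : RegGraph V ρ) (u v : V) : Set (ℕ × ℕ) :=
  {p | p.1 ∈ Theta G u v ∧ p.2 ∈ Theta G u v ∧ p.1 < p.2 ∧
    ∀ l ∈ Theta G u v, ¬ (p.1 < l ∧ l < p.2)}

/-- The regulatory contexts `Ω_v` of a component `v`. -/
def Context (G : RegGraph V ρ) (v : V) : Set (V → ℕ × ℕ) :=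
  {ω | ∀ u, ω u ∈ ActInterval G u v}

/-- `K ∈ 𝒦_G` : on every regulatory context of `v` the value lies in `[0, ρ v]`. -/
def IsParam (G : RegGraph V ρ) (K : Param V) : Prop :=
  ∀ v : V, ∀ ω ∈ Context G v, K v ω ≤ ρ v

/-- The state space `S = ∏_v [0, ρ v]`. -/
def States (ρ : V → ℕ) : Set (V → ℕ) := {s | ∀ v, s v ≤ ρ v}

/-- `s ∈ ω` : the state `s` lies in the context `ω`. -/
def memCtx (ω : V → ℕ × ℕ) (s : V → ℕ) : Prop :=
  ∀ u, (ω u).1 ≤ s u ∧ s u < (ω u).2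

/-- The (unique) regulatory context of `v` containing the state `s`. -/
noncomputable def ctxOf (G : RegGraph V ρ) (v : V) (s : V → ℕ) : V → ℕ × ℕ :=
  fun u => (sSup {m | m ∈ Theta G u v ∧ m ≤ s u}, sInf {m | m ∈ Theta G u v ∧ s u < m})

/-- The asynchronous update function `F^K_v`. -/
noncomputable def F (G : RegGraph V ρ) (K : Param V) (v : V) (s : V → ℕ) : ℕ :=
  if s v < K v (ctxOf G v s) then s v + 1
  else if s v = K v (ctxOf G v s) then s v
  else s v - 1

/-- The derivative `δ(F^K_v)(s) = F^K_v(s) − s_v` (as an integer). -/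
noncomputable def delta (G : RegGraph V ρ) (K : Param V) (v : V) (s : V → ℕ) : ℤ :=
  (F G K v s : ℤ) - (s v : ℤ)

/-- The asynchronous transition system `T_G(K)`, as the set of transitions. -/
noncomputable def TS (G : RegGraph V ρ) (K : Param V) : Set ((V → ℕ) × (V → ℕ)) :=
  {p | p.1 ∈ States ρ ∧ p.2 ∈ States ρ ∧ p.1 ≠ p.2 ∧
    ∃ v : V, p.2 = Function.update p.1 v (F G K v p.1)}

/-- The synchronous transition system of `(G, K)`. -/
noncomputable def SyncTS (G : RegGraph V ρ) (K : Param V) : Set ((V → ℕ) × (V → ℕ)) :=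
  {p | p.1 ∈ States ρ ∧ p.2 ∈ States ρ ∧ ∀ v : V, p.2 v = F G K v p.1}

/-- A parametrization is canonical iff `j − 1 ≤ K_v(ω) ≤ k` for every context with
`ω_v = [j,k)`. -/
def Canonical (G : RegGraph V ρ) (K : Param V) : Prop :=
  ∀ v : V, ∀ ω ∈ Context G v, (ω v).1 - 1 ≤ K v ω ∧ K v ω ≤ (ω v).2

/-- The canonization of a parametrization. -/
noncomputable def CanP (K : Param V) : Param V := fun v ω =>
  if K v ω + 1 < (ω v).1 then (ω v).1 - 1
  else if (ω v).2 < K v ω then (ω v).2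
  else K v ω

/-- A regulatory graph is complete iff it contains every possible edge. -/
def Complete (G : RegGraph V ρ) : Prop :=
  ∀ u v : V, ∀ n : ℕ, 1 ≤ n → n ≤ ρ u → (u, n, v) ∈ G.E

/-- The finite set of all possible edges for activity levels `ρ`. -/
def allEdges (ρ : V → ℕ) : Finset (V × ℕ × V) :=
  Finset.filter (fun e => 1 ≤ e.2.1 ∧ e.2.1 ≤ ρ e.1)
    (Finset.univ ×ˢ (Finset.Icc 1 (Finset.univ.sup ρ)) ×ˢ Finset.univ)

/-- `n_−`: the largest element of `Θ(u,v)` strictly below `n`. -/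
noncomputable def nminus (G : RegGraph V ρ) (u v : V) (n : ℕ) : ℕ :=
  sSup {m | m ∈ Theta G u v ∧ m < n}

/-- `n_+`: the smallest element of `Θ(u,v)` strictly above `n`. -/
noncomputable def nplus (G : RegGraph V ρ) (u v : V) (n : ℕ) : ℕ :=
  sInf {m | m ∈ Theta G u v ∧ n < m}

/-- The parametrization accompanying the completion by the edge `e = (u, n, v)`:
the two contexts obtained by splitting a context of `G` at `n` both inherit the
original value. (`n_−, n_+` are taken w.r.t. the graph `G` before insertion.) -/
noncomputable def CompParam (G : RegGraph V ρ) (K : Param V) (e : V × ℕ × V) : Param V :=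
  fun w ω =>
    if w = e.2.2 ∧ (ω e.1 = (nminus G e.1 e.2.2 e.2.1, e.2.1) ∨
                    ω e.1 = (e.2.1, nplus G e.1 e.2.2 e.2.1))
    then K e.2.2 (Function.update ω e.1 (nminus G e.1 e.2.2 e.2.1, nplus G e.1 e.2.2 e.2.1))
    else K w ω

/-- One completion step: add the least missing edge (w.r.t. the fixed total
order) and extend the parametrization conservatively; complete graphs are fixed. -/
noncomputable def Comp [LinearOrder (V × ℕ × V)] (P : RegGraph V ρ × Param V) :
    RegGraph V ρ × Param V :=
  if h : ((allEdges ρ) \ P.1.E).Nonempty then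
    (⟨insert (((allEdges ρ) \ P.1.E).min' h) P.1.E, by
        intro e' he'
        rcases Finset.mem_insert.mp he' with h1 | h1
        · have hmem := Finset.min'_mem ((allEdges ρ) \ P.1.E) h
          have hall : ((allEdges ρ) \ P.1.E).min' h ∈ allEdges ρ :=
            (Finset.mem_sdiff.mp hmem).1
          rw [h1]
          exact (Finset.mem_filter.mp hall).2
        · exact P.1.valid e' h1⟩,
      CompParam P.1 P.2 (((allEdges ρ) \ P.1.E).min' h))
  else P

/-- `P` is a fixed point of `f` reached by iterating `f` from `start`. -/
def IsFixReached {α : Type*} (f : α → α) (start P : α) : Prop :=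
  (∃ n : ℕ, f^[n] start = P) ∧ f P = P

/-- Equality of parametrized regulatory graphs: the graphs coincide and the
parametrizations agree on all regulatory contexts. -/
def PGEq (A B : RegGraph V ρ × Param V) : Prop :=
  A.1 = B.1 ∧ ∀ v : V, ∀ ω ∈ Context A.1 v, A.2 v ω = B.2 v ω

/-- Replacing the value of `K` at component `v` and context `ω` by `j'`. -/
noncomputable def replaceAt (K : Param V) (v : V) (ω : V → ℕ × ℕ) (j' : ℕ) : Param V :=
  fun w ω' => if w = v ∧ ω' = ω then j' else K w ω'

/-- The edge `e = (u,n,v)` is not observable in the parametrization `K`. -/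
def NotObsParam (G : RegGraph V ρ) (K : Param V) (e : V × ℕ × V) : Prop :=
  ∀ ω ∈ Context G e.2.2, ω e.1 = (e.2.1, nplus G e.1 e.2.2 e.2.1) →
    K e.2.2 ω = K e.2.2 (Function.update ω e.1 (nminus G e.1 e.2.2 e.2.1, e.2.1))

/-- The edge `e = (u,n,v)` is not observable in the transition system `T_G(K)`. -/
def NotObsTS (G : RegGraph V ρ) (K : Param V) (e : V × ℕ × V) : Prop :=
  ∀ s ∈ States ρ, nminus G e.1 e.2.2 e.2.1 ≤ s e.1 → s e.1 < nplus G e.1 e.2.2 e.2.1 →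
    ∃ k ≤ ρ e.2.2, ∀ j : ℕ, nminus G e.1 e.2.2 e.2.1 ≤ j → j < nplus G e.1 e.2.2 e.2.1 →
      delta G K e.2.2 (Function.update s e.1 j) =
        Int.sign ((k : ℤ) - ((Function.update s e.1 j) e.2.2 : ℤ))

/-- The monotone target value `(F^K_v)^{mon}(s)`. -/
noncomputable def mon (G : RegGraph V ρ) (K : Param V) (v : V) (s : V → ℕ) : ℕ :=
  if delta G K v s = 0 then s v
  else if delta G K v s = 1 then
    sInf {j | s v < j ∧ delta G K v (Function.update s v j) ≠ 1}
  else
    sSup {j | j < s v ∧ delta G K v (Function.update s v j) ≠ -1}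

/-- Non-observability of `e = (u,n,v)` in `T_G(K)` phrased via monotone target values. -/
def NotObsTSmon (G : RegGraph V ρ) (K : Param V) (e : V × ℕ × V) : Prop :=
  ∀ s ∈ States ρ, nminus G e.1 e.2.2 e.2.1 ≤ s e.1 → s e.1 < nplus G e.1 e.2.2 e.2.1 →
    ∀ j : ℕ, nminus G e.1 e.2.2 e.2.1 ≤ j → j < nplus G e.1 e.2.2 e.2.1 →
      delta G K e.2.2 (Function.update s e.1 j) =
        Int.sign ((mon G K e.2.2 s : ℤ) - ((Function.update s e.1 j) e.2.2 : ℤ))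

/-- In the normalization algorithm: the context below the current one
(the `v`-interval is replaced by its predecessor interval `[n_{i−1}, n_i)`). -/
noncomputable def updLow (G : RegGraph V ρ) (v : V) (ω : V → ℕ × ℕ) : V → ℕ × ℕ :=
  Function.update ω v (sSup {m | m ∈ Theta G v v ∧ m < (ω v).1}, (ω v).1)

/-- In the normalization algorithm: the context above the current one
(the `v`-interval is replaced by its successor interval `[n_{i+1}, n_{i+2})`). -/
noncomputable def updHigh (G : RegGraph V ρ) (v : V) (ω : V → ℕ × ℕ) : V → ℕ × ℕ :=
  Function.update ω v ((ω v).2, sInf {m | m ∈ Theta G v v ∧ (ω v).2 < m})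

/-- The recursive normalization algorithm `Norm(K, v, ω)` of the paper, as an
inductive big-step relation: `NormRel G K v ω r` holds iff the recursion
started at `ω` terminates with result `r`. -/
inductive NormRel (G : RegGraph V ρ) (K : Param V) (v : V) : (V → ℕ × ℕ) → ℕ → Prop
  | inside (ω : V → ℕ × ℕ) (h1 : (ω v).1 ≤ K v ω) (h2 : K v ω < (ω v).2) :
      NormRel G K v ω (K v ω)
  | belowStop (ω : V → ℕ × ℕ) (h : K v ω < (ω v).1)
      (h2 : (ω v).1 - 1 ≤ K v (updLow G v ω)) :
      NormRel G K v ω ((ω v).1 - 1)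
  | belowRec (ω : V → ℕ × ℕ) (r : ℕ) (h : K v ω < (ω v).1)
      (h2 : K v (updLow G v ω) < (ω v).1 - 1)
      (hrec : NormRel G K v (updLow G v ω) r) :
      NormRel G K v ω r
  | aboveStop (ω : V → ℕ × ℕ) (h : (ω v).2 ≤ K v ω)
      (h2 : K v (updHigh G v ω) ≤ (ω v).2) :
      NormRel G K v ω ((ω v).2)
  | aboveRec (ω : V → ℕ × ℕ) (r : ℕ) (h : (ω v).2 ≤ K v ω)
      (h2 : (ω v).2 < K v (updHigh G v ω))
      (hrec : NormRel G K v (updHigh G v ω) r) :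
      NormRel G K v ω r

/-- The normalized parametrization: each context gets the common monotone
target value of its states (represented by the lower corner of the context). -/
noncomputable def NormPm (G : RegGraph V ρ) (K : Param V) : Param V :=
  fun v ω => mon G K v (fun u => (ω u).1)

/-- The edges of `G` that are not observable in `N`. -/
noncomputable def nonObsEdges (G : RegGraph V ρ) (N : Param V) : Finset (V × ℕ × V) :=
  G.E.filter (fun e => NotObsParam G N e)

/-- The parametrization accompanying the removal of the non-observable edge
`e = (u,n,v)`: the two contexts merged into one pass on their common value. -/
noncomputable def MinParam (G : RegGraph V ρ) (N : Param V) (e : V × ℕ × V) : Param V :=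
  fun w ω =>
    if w = e.2.2 ∧ ω e.1 = (nminus G e.1 e.2.2 e.2.1, nplus G e.1 e.2.2 e.2.1)
    then N e.2.2 (Function.update ω e.1 (nminus G e.1 e.2.2 e.2.1, e.2.1))
    else N w ω

/-- One minimization step: remove the least edge (w.r.t. the fixed total order)
that is not observable in `N`; if all edges are observable, do nothing. -/
noncomputable def Minim [LinearOrder (V × ℕ × V)] (P : RegGraph V ρ × Param V) :
    RegGraph V ρ × Param V :=
  if h : (nonObsEdges P.1 P.2).Nonempty then
    (⟨P.1.E.erase ((nonObsEdges P.1 P.2).min' h),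
        fun e' he' => P.1.valid e' (Finset.mem_of_mem_erase he')⟩,
      MinParam P.1 P.2 ((nonObsEdges P.1 P.2).min' h))
  else P


theorem h_ctxOf_mem (G : RegGraph V ρ) (v : V) (s : V → ℕ) (hs : s ∈ States ρ) :
    ctxOf G v s ∈ Context G v := by
  intro u
  have hsu : s u ≤ ρ u := hs u
  have hA : sSup {m | m ∈ Theta G u v ∧ m ≤ s u} ∈ {m | m ∈ Theta G u v ∧ m ≤ s u} := by
    apply Nat.sSup_mem
    · exact ⟨0, by simp [Theta]⟩
    · exact ⟨s u, fun m hm => hm.2⟩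
  have hB : sInf {m | m ∈ Theta G u v ∧ s u < m} ∈ {m | m ∈ Theta G u v ∧ s u < m} := by
    apply Nat.sInf_mem
    exact ⟨ρ u + 1, by simp [Theta], by omega⟩
  refine ⟨hA.1, hB.1, lt_of_le_of_lt hA.2 hB.2, ?_⟩
  rintro l hl ⟨h1, h2⟩
  simp only [ctxOf] at h1 h2
  by_cases hls : l ≤ s u
  · have : l ≤ sSup {m | m ∈ Theta G u v ∧ m ≤ s u} :=
      le_csSup ⟨s u, fun m hm => hm.2⟩ ⟨hl, hls⟩
    omega
  · have : sInf {m | m ∈ Theta G u v ∧ s u < m} ≤ l := Nat.sInf_le ⟨hl, by omega⟩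
    omega

theorem h_theta (G : RegGraph V ρ) (hG : Complete G) (u v : V) (m : ℕ) :
    m ∈ Theta G u v ↔ m ≤ ρ u + 1 := by
  constructor
  · rintro (h | h | h)
    · have := (G.valid _ h).2
      simp only at this
      omega
    · omega
    · have : m = ρ u + 1 := h
      omega
  · intro h
    by_cases h0 : m = 0
    · right; left; exact h0
    by_cases h1 : m = ρ u + 1
    · right; right; exact h1
    · left; exact hG u v m (by omega) (by omega)

theorem h_context (G : RegGraph V ρ) (hG : Complete G) (v : V) (ω : V → ℕ × ℕ)
    (hω : ω ∈ Context G v) (u : V) : (ω u).2 = (ω u).1 + 1 ∧ (ω u).1 ≤ ρ u := by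
  obtain ⟨h1, h2, h3, h4⟩ := hω u
  rw [h_theta G hG] at h1 h2
  have := h4 ((ω u).1 + 1) ((h_theta G hG u v _).2 (by omega))
  omega

theorem h_ctxOf (G : RegGraph V ρ) (hG : Complete G) (v : V) (s : V → ℕ)
    (hs : s ∈ States ρ) : ctxOf G v s = fun u => (s u, s u + 1) := by
  funext u
  have hsu : s u ≤ ρ u := hs u
  refine Prod.ext ?_ ?_
  · apply IsGreatest.csSup_eq
    exact ⟨⟨(h_theta G hG u v _).2 (by omega), le_rfl⟩, fun m hm => hm.2⟩
  · apply IsLeast.csInf_eq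
    exact ⟨⟨(h_theta G hG u v _).2 (by omega), by omega⟩, fun m hm => hm.2⟩

theorem h_F_le (G : RegGraph V ρ) (K : Param V) (hK : IsParam G K) (v : V) (s : V → ℕ)
    (hs : s ∈ States ρ) : F G K v s ≤ ρ v := by
  have h := hK v _ (h_ctxOf_mem G v s hs)
  have hsv : s v ≤ ρ v := hs v
  unfold F
  split_ifs <;> omega

theorem h_F_near (G : RegGraph V ρ) (K : Param V) (v : V) (s : V → ℕ) :
    s v - 1 ≤ F G K v s ∧ F G K v s ≤ s v + 1 := by
  unfold F
  split_ifs <;> omega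

theorem h_F_eq (G : RegGraph V ρ) (K : Param V) (v : V) (s : V → ℕ)
    (h1 : s v - 1 ≤ K v (ctxOf G v s)) (h2 : K v (ctxOf G v s) ≤ s v + 1) :
    F G K v s = K v (ctxOf G v s) := by
  unfold F
  split_ifs <;> omega

theorem h_TS_F (G : RegGraph V ρ) (K K' : Param V) (hK : IsParam G K)
    (h : TS G K ⊆ TS G K') (v : V) (s : V → ℕ) (hs : s ∈ States ρ)
    (hne : F G K v s ≠ s v) : F G K' v s = F G K v s := by
  have hmem : (s, Function.update s v (F G K v s)) ∈ TS G K := by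
    refine ⟨hs, ?_, ?_, v, rfl⟩
    · intro u
      by_cases hu : u = v
      · subst hu
        simpa using h_F_le G K hK u s hs
      · simpa [hu] using hs u
    · intro he
      have := congrFun he v
      simp at this
      exact hne this.symm
  obtain ⟨-, -, -, w, hw⟩ := h hmem
  have hv := congrFun hw v
  by_cases hwv : v = w
  · subst hwv
    simpa using hv.symm
  · simp [hwv] at hv
    exact absurd hv hne

theorem h_TS_F_eq (G : RegGraph V ρ) (K K' : Param V) (hK : IsParam G K) (hK' : IsParam G K')
    (h : TS G K = TS G K') (v : V) (s : V → ℕ) (hs : s ∈ States ρ) :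
    F G K v s = F G K' v s := by
  by_cases h1 : F G K v s = s v
  · by_cases h2 : F G K' v s = s v
    · rw [h1, h2]
    · exact h_TS_F G K' K hK' h.symm.subset v s hs h2
  · exact (h_TS_F G K K' hK h.subset v s hs h1).symm

theorem h_TS_congr (G G' : RegGraph V ρ) (K K' : Param V)
    (h : ∀ s ∈ States ρ, ∀ v, F G K v s = F G' K' v s) : TS G K = TS G' K' := by
  ext ⟨s, t⟩
  simp only [TS, Set.mem_setOf_eq]
  refine and_congr_right fun hs => ?_
  simp only [h s hs]

/-- For a complete regulatory graph `G`, the map `T_G` is a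
bijection between the canonical parametrizations `𝒞_G` of `G` and the set
`𝒯_ρ` of all asynchronous transition systems generated by regulatory graphs
sharing `ρ`: it is injective on `𝒞_G` (up to agreement on contexts) and its
image on `𝒞_G` equals `𝒯_ρ`. -/
theorem bijection_canonical_TS {V : Type*} [DecidableEq V] [Fintype V]
    {ρ : V → ℕ} (hρ : ∀ v, 1 ≤ ρ v) (G : RegGraph V ρ) (hG : Complete G) :
    (∀ C C' : Param V, IsParam G C → IsParam G C' → Canonical G C → Canonical G C' →
      TS G C = TS G C' → ∀ v : V, ∀ ω ∈ Context G v, C v ω = C' v ω) ∧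
    {T : Set ((V → ℕ) × (V → ℕ)) | ∃ C : Param V, IsParam G C ∧ Canonical G C ∧ TS G C = T} =
      {T : Set ((V → ℕ) × (V → ℕ)) |
        ∃ (G' : RegGraph V ρ) (K : Param V), IsParam G' K ∧ TS G' K = T} := by
  constructor
  · intro C C' hC hC' cC cC' hT v ω hω
    have hs : (fun u => (ω u).1) ∈ States ρ := fun u => (h_context G hG v ω hω u).2
    have hctx : ctxOf G v (fun u => (ω u).1) = ω := by
      rw [h_ctxOf G hG v _ hs]
      funext u
      exact Prod.ext rfl (h_context G hG v ω hω u).1.symm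
    have key := h_TS_F_eq G C C' hC hC' hT v _ hs
    have e := (h_context G hG v ω hω v).1
    have b := cC v ω hω
    have b' := cC' v ω hω
    rw [e] at b b'
    rw [h_F_eq G C v _ (by rw [hctx]; exact b.1) (by rw [hctx]; exact b.2),
      h_F_eq G C' v _ (by rw [hctx]; exact b'.1) (by rw [hctx]; exact b'.2), hctx] at key
    exact key
  · ext T
    constructor
    · rintro ⟨C, hC, -, rfl⟩
      exact ⟨G, C, hC, rfl⟩
    · rintro ⟨G', K, hK, rfl⟩
      refine ⟨fun v ω => F G' K v (fun u => (ω u).1), ?_, ?_, ?_⟩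
      · intro v ω hω
        exact h_F_le G' K hK v _ fun u => (h_context G hG v ω hω u).2
      · intro v ω hω
        rw [(h_context G hG v ω hω v).1]
        exact h_F_near G' K v (fun u => (ω u).1)
      · apply h_TS_congr
        intro s hs v
        have hn := h_F_near G' K v s
        have := h_F_eq G (fun v ω => F G' K v (fun u => (ω u).1)) v s
          (by rw [h_ctxOf G hG v s hs]; exact hn.1) (by rw [h_ctxOf G hG v s hs]; exact hn.2)
        rw [this, h_ctxOf G hG v s hs]

end MVReg
end

section
/- Canonization is conservative: for every multi-valued regulatory graph G and every parametrization K ∈ K_G, if Can(G,K)=(G,C) then T_G(K) = T_G(C), i.e., K and its canonization generate the same asynchronous transition system. -/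
/-!
Formalization of multi-valued regulatory graphs (Thomas networks),
their parametrizations, asynchronous transition systems,
canonization, completion, normalization and minimization.
-/

namespace MVReg

open Classical

variable {V : Type*} [DecidableEq V] [Fintype V] {ρ : V → ℕ}

/-- Canonization does not change the update function on states. -/
theorem F_canP {V : Type*} [DecidableEq V] [Fintype V]
    {ρ : V → ℕ} (G : RegGraph V ρ) (K : Param V) (v : V) (s : V → ℕ)
    (hs : s ∈ States ρ) : F G (CanP K) v s = F G K v s := by
  have h1 : (ctxOf G v s v).1 ≤ s v := by
    apply csSup_le
    · exact ⟨0, by simp [Theta], Nat.zero_le _⟩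
    · rintro b ⟨_, hb⟩
      exact hb
  have h2 : s v < (ctxOf G v s v).2 := by
    have hne : {m | m ∈ Theta G v v ∧ s v < m}.Nonempty :=
      ⟨ρ v + 1, by simp [Theta], Nat.lt_succ_of_le (hs v)⟩
    exact (Nat.sInf_mem hne).2
  unfold F CanP
  split_ifs <;> omega

/-- Canonization is conservative: a parametrization and its
canonization generate the same asynchronous transition system. -/
theorem canonization_conservative {V : Type*} [DecidableEq V] [Fintype V]
    {ρ : V → ℕ} (hρ : ∀ v, 1 ≤ ρ v) (G : RegGraph V ρ)
    (K : Param V) (hK : IsParam G K) :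
    TS G K = TS G (CanP K) := by
  ext ⟨s, t⟩
  constructor
  · rintro ⟨hs, ht, hne, v, hv⟩
    exact ⟨hs, ht, hne, v, by rw [F_canP G K v s hs]; exact hv⟩
  · rintro ⟨hs, ht, hne, v, hv⟩
    exact ⟨hs, ht, hne, v, by rw [F_canP G K v s hs] at hv; exact hv⟩

end MVReg
end

section
/- Let G be a multi-valued regulatory graph, K ∈ K_G, v∈V and ω∈Ω_v. If K_v(ω) < ω_v (i.e., K_v(ω) is below every element of the interval ω_v), then replacing the value K_v(ω) by any j' with 0 ≤ j' < ω_v yields a parametrization K' with T_G(K') = T_G(K); symmetrically, if K_v(ω) > ω_v, then replacing K_v(ω) by any j' with ω_v < j' ≤ ρ(v) yields K' with T_G(K') = T_G(K). -/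
/-!
Formalization of multi-valued regulatory graphs (Thomas networks),
their parametrizations, asynchronous transition systems,
canonization, completion, normalization and minimization.
-/

namespace MVReg

open Classical

variable {V : Type*} [DecidableEq V] [Fintype V] {ρ : V → ℕ}

theorem ctxOf_bounds {V : Type*} [DecidableEq V] [Fintype V]
    {ρ : V → ℕ} (G : RegGraph V ρ) (v : V) (s : V → ℕ) (hs : s ∈ States ρ) :
    memCtx (ctxOf G v s) s := by
  intro u
  constructor
  · have hne : {m | m ∈ Theta G u v ∧ m ≤ s u}.Nonempty :=
      ⟨0, by simp [Theta], Nat.zero_le _⟩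
    exact csSup_le hne (fun m hm => hm.2)
  · have hne : {m | m ∈ Theta G u v ∧ s u < m}.Nonempty :=
      ⟨ρ u + 1, by simp [Theta], Nat.lt_succ_of_le (hs u)⟩
    exact (Nat.sInf_mem hne).2

theorem TS_congr {V : Type*} [DecidableEq V] [Fintype V]
    {ρ : V → ℕ} (G : RegGraph V ρ) (K K' : Param V)
    (h : ∀ s ∈ States ρ, ∀ w, F G K w s = F G K' w s) : TS G K = TS G K' := by
  ext p
  constructor
  · rintro ⟨h1, h2, h3, w, hw⟩
    exact ⟨h1, h2, h3, w, by rw [← h _ h1]; exact hw⟩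
  · rintro ⟨h1, h2, h3, w, hw⟩
    exact ⟨h1, h2, h3, w, by rw [h _ h1]; exact hw⟩

/-- If `K_v(ω) < ω_v` (below every element of the interval
`ω_v = [j,k)`, i.e. `K_v(ω) < j`), then replacing `K_v(ω)` by any `j' < ω_v`
is conservative; symmetrically if `K_v(ω) > ω_v` (i.e. `K_v(ω) ≥ k`), then
replacing it by any `j'` with `ω_v < j' ≤ ρ v` is conservative. -/
theorem replace_value_conservative {V : Type*} [DecidableEq V] [Fintype V]
    {ρ : V → ℕ} (hρ : ∀ v, 1 ≤ ρ v) (G : RegGraph V ρ)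
    (K : Param V) (hK : IsParam G K)
    (v : V) (ω : V → ℕ × ℕ) (hω : ω ∈ Context G v) :
    (∀ j' : ℕ, K v ω < (ω v).1 → j' < (ω v).1 →
      TS G (replaceAt K v ω j') = TS G K) ∧
    (∀ j' : ℕ, (ω v).2 ≤ K v ω → (ω v).2 ≤ j' → j' ≤ ρ v →
      TS G (replaceAt K v ω j') = TS G K) := by
  constructor
  · intro j' h1 h2
    refine TS_congr G _ _ fun s hs w => ?_
    by_cases hc : w = v ∧ ctxOf G w s = ω
    · obtain ⟨rfl, rfl⟩ := hc
      have hb := ctxOf_bounds G w s hs w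
      simp only [F, replaceAt, and_self, if_true]
      split_ifs <;> omega
    · simp only [F, replaceAt, if_neg hc]
  · intro j' h1 h2 _
    refine TS_congr G _ _ fun s hs w => ?_
    by_cases hc : w = v ∧ ctxOf G w s = ω
    · obtain ⟨rfl, rfl⟩ := hc
      have hb := ctxOf_bounds G w s hs w
      simp only [F, replaceAt, and_self, if_true]
      split_ifs <;> omega
    · simp only [F, replaceAt, if_neg hc]

end MVReg
end

section
/- Completion is sound: for every multi-valued regulatory graph G=(V,E,ρ) and every parametrization K ∈ K_G, if Comp(G,K)=(Ĝ,K̂) then Ĝ is a valid multi-valued regulatory graph and K̂ is a well-defined parametrization of Ĝ (i.e., K̂_w is defined on all of the regulatory contexts Ω̂_w of Ĝ for every w∈V, with values in [0,ρ(w)]). -/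
/-!
Formalization of multi-valued regulatory graphs (Thomas networks),
their parametrizations, asynchronous transition systems,
canonization, completion, normalization and minimization.
-/

namespace MVReg

open Classical

variable {V : Type*} [DecidableEq V] [Fintype V] {ρ : V → ℕ}

theorem mem_Theta_iff (G : RegGraph V ρ) (u v : V) (m : ℕ) :
    m ∈ Theta G u v ↔ (u, m, v) ∈ G.E ∨ m = 0 ∨ m = ρ u + 1 := by
  simp [Theta]
  tauto

theorem nminus_spec (G : RegGraph V ρ) (u v : V) (n : ℕ) (hn : 1 ≤ n) :
    nminus G u v n ∈ Theta G u v ∧ nminus G u v n < n ∧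
      ∀ l ∈ Theta G u v, l < n → l ≤ nminus G u v n := by
  have hne : ({m | m ∈ Theta G u v ∧ m < n} : Set ℕ).Nonempty :=
    ⟨0, (mem_Theta_iff G u v 0).2 (Or.inr (Or.inl rfl)), hn⟩
  have hb : BddAbove ({m | m ∈ Theta G u v ∧ m < n} : Set ℕ) := ⟨n, fun m hm => hm.2.le⟩
  have h := Nat.sSup_mem hne hb
  exact ⟨h.1, h.2, fun l h1 h2 => le_csSup hb ⟨h1, h2⟩⟩

theorem nplus_spec (G : RegGraph V ρ) (u v : V) (n : ℕ) (hn : n ≤ ρ u) :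
    nplus G u v n ∈ Theta G u v ∧ n < nplus G u v n ∧
      ∀ l ∈ Theta G u v, n < l → nplus G u v n ≤ l := by
  have hne : ({m | m ∈ Theta G u v ∧ n < m} : Set ℕ).Nonempty :=
    ⟨ρ u + 1, (mem_Theta_iff G u v _).2 (Or.inr (Or.inr rfl)), Nat.lt_succ_of_le hn⟩
  have h := Nat.sInf_mem hne
  exact ⟨h.1, h.2, fun l h1 h2 => Nat.sInf_le ⟨h1, h2⟩⟩

theorem isParam_step (G G' : RegGraph V ρ) (K : Param V) (hK : IsParam G K)
    (u v : V) (n : ℕ) (h1 : 1 ≤ n) (h2 : n ≤ ρ u) (hnot : (u, n, v) ∉ G.E)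
    (hmem : ∀ x, x ∈ G'.E ↔ x = (u, n, v) ∨ x ∈ G.E) :
    IsParam G' (CompParam G K (u, n, v)) := by
  have hT : ∀ a b m, m ∈ Theta G' a b ↔ (a = u ∧ m = n ∧ b = v) ∨ m ∈ Theta G a b := by
    intro a b m
    rw [mem_Theta_iff, mem_Theta_iff, hmem]
    simp only [Prod.mk.injEq]
    tauto
  have hnT : n ∉ Theta G u v := by
    rw [mem_Theta_iff]
    rintro (h | h | h)
    · exact hnot h
    · omega
    · omega
  have hI : ∀ a b, ¬ (a = u ∧ b = v) → ∀ p ∈ ActInterval G' a b, p ∈ ActInterval G a b := by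
    intro a b hab p hp
    have hE : Theta G' a b = Theta G a b := by
      ext m
      rw [hT]
      exact or_iff_right (fun h => hab ⟨h.1, h.2.2⟩)
    simpa [ActInterval, hE] using hp
  obtain ⟨m1, m2, m3⟩ := nminus_spec G u v n h1
  obtain ⟨p1, p2, p3⟩ := nplus_spec G u v n h2
  intro w ω hω
  unfold CompParam
  split_ifs with h
  · obtain ⟨rfl, -⟩ := h
    apply hK
    intro a
    by_cases ha : a = u
    · subst ha
      simp only [Function.update_self]
      refine ⟨m1, p1, m2.trans p2, ?_⟩
      rintro l hl ⟨hl1, hl2⟩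
      simp only at hl1 hl2
      rcases lt_trichotomy l n with h | h | h
      · exact absurd (m3 l hl h) (by omega)
      · exact hnT (h ▸ hl)
      · exact absurd (p3 l hl h) (by omega)
    · simp only [Function.update_of_ne ha]
      exact hI a _ (fun h => ha h.1) _ (hω a)
  · apply hK
    intro a
    by_cases hab : a = u ∧ w = v
    · obtain ⟨rfl, rfl⟩ := hab
      have hh := hω a
      obtain ⟨q1, q2, q3, q4⟩ := hh
      have q4' : ∀ l ∈ Theta G a w, ¬ ((ω a).1 < l ∧ l < (ω a).2) :=
        fun l hl => q4 l ((hT _ _ _).2 (Or.inr hl))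
      have hx : (ω a).1 ≠ n := by
        intro hx
        refine h ⟨rfl, Or.inr (Prod.ext hx ?_)⟩
        have hy : (ω a).2 ∈ Theta G a w := by
          rcases (hT _ _ _).1 q2 with h | h
          · omega
          · exact h
        have := p3 _ hy (by omega)
        have := q4' _ p1
        simp only
        omega
      have hy : (ω a).2 ≠ n := by
        intro hy
        refine h ⟨rfl, Or.inl (Prod.ext ?_ hy)⟩
        have hx : (ω a).1 ∈ Theta G a w := by
          rcases (hT _ _ _).1 q1 with h | h
          · omega
          · exact h
        have := m3 _ hx (by omega)
        have := q4' _ m1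
        simp only
        omega
      refine ⟨?_, ?_, q3, q4'⟩
      · exact ((hT _ _ _).1 q1).resolve_left (fun h => hx h.2.1)
      · exact ((hT _ _ _).1 q2).resolve_left (fun h => hy h.2.1)
    · exact hI a _ hab _ (hω a)

/-- Completion is sound: the completed graph is a valid
regulatory graph and the extended parametrization is a well-defined
parametrization of it. -/
theorem completion_sound {V : Type*} [DecidableEq V] [Fintype V]
    [LinearOrder (V × ℕ × V)] {ρ : V → ℕ} (hρ : ∀ v, 1 ≤ ρ v)
    (G : RegGraph V ρ) (K : Param V) (hK : IsParam G K) :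
    (∀ e ∈ (Comp (G, K)).1.E, 1 ≤ e.2.1 ∧ e.2.1 ≤ ρ e.1) ∧
    IsParam (Comp (G, K)).1 (Comp (G, K)).2 := by
  refine ⟨(Comp (G, K)).1.valid, ?_⟩
  unfold Comp
  split_ifs with h
  · have hm := Finset.mem_sdiff.mp (Finset.min'_mem _ h)
    have hv := (Finset.mem_filter.mp hm.1).2
    exact isParam_step G _ K hK _ _ _ hv.1 hv.2 hm.2 (fun x => Finset.mem_insert)
  · exact hK

end MVReg
end

section
/- Completion is conservative: for every multi-valued regulatory graph G and every parametrization K ∈ K_G, if Comp(G,K)=(Ĝ,K̂) then T_G(K) = T_{Ĝ}(K̂), i.e., the completed parametrized graph generates the same asynchronous transition system. -/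
/-!
Formalization of multi-valued regulatory graphs (Thomas networks),
their parametrizations, asynchronous transition systems,
canonization, completion, normalization and minimization.
-/

namespace MVReg

open Classical

variable {V : Type*} [DecidableEq V] [Fintype V] {ρ : V → ℕ}

theorem aux_great (T : Set ℕ) (h0 : 0 ∈ T) (x : ℕ) :
    IsGreatest {m | m ∈ T ∧ m ≤ x} (sSup {m | m ∈ T ∧ m ≤ x}) := by
  have hb : BddAbove {m | m ∈ T ∧ m ≤ x} := ⟨x, fun m hm => hm.2⟩
  exact ⟨Nat.sSup_mem ⟨0, h0, Nat.zero_le _⟩ hb, fun m hm => le_csSup hb hm⟩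

theorem aux_least (T : Set ℕ) (x N : ℕ) (hN : N ∈ T) (hx : x < N) :
    IsLeast {m | m ∈ T ∧ x < m} (sInf {m | m ∈ T ∧ x < m}) :=
  ⟨Nat.sInf_mem ⟨N, hN, hx⟩, fun _ hm => Nat.sInf_le hm⟩

theorem aux_split (T T' : Set ℕ) (n x N : ℕ) (h0 : 0 ∈ T) (hN : N ∈ T) (hx : x < N)
    (hn : n ∉ T) (hT' : ∀ m, m ∈ T' ↔ m = n ∨ m ∈ T)
    (a b a' b' : ℕ) (ha : a = sSup {m | m ∈ T ∧ m ≤ x}) (hb : b = sInf {m | m ∈ T ∧ x < m})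
    (ha' : a' = sSup {m | m ∈ T' ∧ m ≤ x}) (hb' : b' = sInf {m | m ∈ T' ∧ x < m}) :
    (sSup {m | m ∈ T ∧ m < n} = a ∧ sInf {m | m ∈ T ∧ n < m} = b ∧
      ((a' = a ∧ b' = n) ∨ (a' = n ∧ b' = b))) ∨
    (a' = a ∧ b' = b ∧ a ≠ n ∧ b ≠ n) := by
  obtain ⟨⟨ga1, ga2⟩, ga3⟩ := aux_great T h0 x
  obtain ⟨⟨gb1, gb2⟩, gb3⟩ := aux_least T x N hN hx
  rw [← ha] at ga1 ga2 ga3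
  rw [← hb] at gb1 gb2 gb3
  have ga4 : ∀ m ∈ T, m ≤ x → m ≤ a := fun m h1 h2 => ga3 ⟨h1, h2⟩
  have gb4 : ∀ m ∈ T, x < m → b ≤ m := fun m h1 h2 => gb3 ⟨h1, h2⟩
  have hna : a ≠ n := fun h => hn (h ▸ ga1)
  have hnb : b ≠ n := fun h => hn (h ▸ gb1)
  have mkS : ∀ c, c ∈ T' → c ≤ x → (∀ m, m ∈ T' → m ≤ x → m ≤ c) → a' = c := fun c h1 h2 h3 => by
    rw [ha']; exact IsGreatest.csSup_eq ⟨⟨h1, h2⟩, fun m hm => h3 m hm.1 hm.2⟩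
  have mkI : ∀ c, c ∈ T' → x < c → (∀ m, m ∈ T' → x < m → c ≤ m) → b' = c := fun c h1 h2 h3 => by
    rw [hb']; exact IsLeast.csInf_eq ⟨⟨h1, h2⟩, fun m hm => h3 m hm.1 hm.2⟩
  simp only [hT'] at mkS mkI
  by_cases hin : a < n ∧ n < b
  · left
    refine ⟨IsGreatest.csSup_eq ⟨⟨ga1, hin.1⟩, ?_⟩, IsLeast.csInf_eq ⟨⟨gb1, hin.2⟩, ?_⟩, ?_⟩
    · rintro m ⟨h1, h2⟩
      have := ga4 m h1
      have := gb4 m h1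
      omega
    · rintro m ⟨h1, h2⟩
      have := ga4 m h1
      have := gb4 m h1
      omega
    · by_cases hxn : x < n
      · left
        refine ⟨mkS a (Or.inr ga1) ga2 ?_, mkI n (Or.inl rfl) hxn ?_⟩
        · rintro m (h1 | h1) h2
          · omega
          · exact ga4 m h1 h2
        · rintro m (h1 | h1) h2
          · omega
          · have := gb4 m h1 h2
            omega
      · right
        refine ⟨mkS n (Or.inl rfl) (by omega) ?_, mkI b (Or.inr gb1) gb2 ?_⟩
        · rintro m (h1 | h1) h2
          · omega
          · have := ga4 m h1 h2
            omega
        · rintro m (h1 | h1) h2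
          · omega
          · exact gb4 m h1 h2
  · right
    refine ⟨mkS a (Or.inr ga1) ga2 ?_, mkI b (Or.inr gb1) gb2 ?_, hna, hnb⟩
    · rintro m (h1 | h1) h2
      · omega
      · exact ga4 m h1 h2
    · rintro m (h1 | h1) h2
      · omega
      · exact gb4 m h1 h2

theorem aux_K {V : Type*} [DecidableEq V] {ρ : V → ℕ} (G G' : RegGraph V ρ) (K : Param V)
    (u : V) (n : ℕ) (v : V) (h1 : 1 ≤ n) (h2 : n ≤ ρ u) (hn : (u, n, v) ∉ G.E)
    (hE : ∀ e, e ∈ G'.E ↔ e = (u, n, v) ∨ e ∈ G.E) (s : V → ℕ) (hs : s ∈ States ρ) (w : V) :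
    CompParam G K (u, n, v) w (ctxOf G' w s) = K w (ctxOf G w s) := by
  have hne : ∀ x y, ¬ (x = u ∧ y = v) → Theta G' x y = Theta G x y := by
    intro x y hxy
    ext m
    simp only [Theta, Set.mem_union, Set.mem_setOf_eq, hE, Prod.mk.injEq]
    tauto
  have hctx : ∀ x y, ¬ (x = u ∧ y = v) → ctxOf G' y s x = ctxOf G y s x := by
    intro x y hxy
    simp only [ctxOf, hne x y hxy]
  by_cases hw : w = v
  · subst hw
    have hT' : ∀ m, m ∈ Theta G' u w ↔ m = n ∨ m ∈ Theta G u w := by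
      intro m
      simp only [Theta, Set.mem_union, Set.mem_setOf_eq, hE, Prod.mk.injEq]
      tauto
    have hnT : n ∉ Theta G u w := by
      simp only [Theta, Set.mem_union, Set.mem_setOf_eq, Set.mem_insert_iff,
        Set.mem_singleton_iff]
      rintro (h | h | h)
      · exact hn h
      · omega
      · omega
    have key := aux_split (Theta G u w) (Theta G' u w) n (s u) (ρ u + 1)
      (by simp [Theta]) (by simp [Theta]) (Nat.lt_succ_of_le (hs u)) hnT hT'
      (ctxOf G w s u).1 (ctxOf G w s u).2 (ctxOf G' w s u).1 (ctxOf G' w s u).2 rfl rfl rfl rfl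
    rcases key with ⟨k1, k2, k3⟩ | ⟨k1, k2, k3, k4⟩
    · have hm : nminus G u w n = (ctxOf G w s u).1 := k1
      have hp : nplus G u w n = (ctxOf G w s u).2 := k2
      have hc : ctxOf G' w s u = (nminus G u w n, n) ∨ ctxOf G' w s u = (n, nplus G u w n) := by
        rw [hm, hp]
        rcases k3 with ⟨k, l⟩ | ⟨k, l⟩
        · left; exact Prod.ext k l
        · right; exact Prod.ext k l
      unfold CompParam
      rw [if_pos ⟨rfl, hc⟩]
      congr 1
      funext x
      by_cases hx : x = u
      · subst hx
        simp [hm, hp]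
      · simp only [Function.update_of_ne hx]
        exact hctx x w (fun h => hx h.1)
    · have : ctxOf G' w s = ctxOf G w s := by
        funext x
        by_cases hx : x = u
        · subst hx
          exact Prod.ext k1 k2
        · exact hctx x w (fun h => hx h.1)
      rw [this]
      unfold CompParam
      rw [if_neg]
      rintro ⟨_, h | h⟩
      · exact k4 (congrArg Prod.snd h)
      · exact k3 (congrArg Prod.fst h)
  · have : ctxOf G' w s = ctxOf G w s := funext fun x => hctx x w (fun h => hw h.2)
    rw [this]
    unfold CompParam
    rw [if_neg]
    exact fun h => hw h.1

theorem aux_TS {V : Type*} [DecidableEq V] {ρ : V → ℕ} (G G' : RegGraph V ρ) (K K' : Param V)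
    (h : ∀ s ∈ States ρ, ∀ w, K' w (ctxOf G' w s) = K w (ctxOf G w s)) :
    TS G K = TS G' K' := by
  ext p
  simp only [TS, Set.mem_setOf_eq]
  refine and_congr_right fun hp => ?_
  have : ∀ v, F G K v p.1 = F G' K' v p.1 := fun v => by simp only [F, h p.1 hp v]
  simp only [this]

/-- Completion is conservative: the completed parametrized
graph generates the same asynchronous transition system. -/
theorem completion_conservative {V : Type*} [DecidableEq V] [Fintype V]
    [LinearOrder (V × ℕ × V)] {ρ : V → ℕ} (hρ : ∀ v, 1 ≤ ρ v)
    (G : RegGraph V ρ) (K : Param V) (hK : IsParam G K) :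
    TS G K = TS (Comp (G, K)).1 (Comp (G, K)).2 := by
  apply aux_TS
  intro s hs w
  unfold Comp
  split_ifs with h
  · have hmem := Finset.mem_sdiff.mp (Finset.min'_mem _ h)
    have hall := (Finset.mem_filter.mp hmem.1).2
    exact aux_K G _ K _ _ _ hall.1 hall.2 hmem.2 (fun e => Finset.mem_insert) s hs w
  · rfl

end MVReg
end

section
/- For every multi-valued regulatory graph G and every parametrization K ∈ K_G, the recursive sequence Comp(G,K), Comp(Comp(G,K)), … converges: it becomes constant after finitely many steps at a fixed point (G^c,K^c) of Comp, and the graph G^c is complete. -/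
/-!
Formalization of multi-valued regulatory graphs (Thomas networks),
their parametrizations, asynchronous transition systems,
canonization, completion, normalization and minimization.
-/

namespace MVReg

open Classical

variable {V : Type*} [DecidableEq V] [Fintype V] {ρ : V → ℕ}

theorem mem_allEdges_of {V : Type*} [DecidableEq V] [Fintype V] {ρ : V → ℕ}
    (u v : V) (n : ℕ) (h1 : 1 ≤ n) (h2 : n ≤ ρ u) : (u, n, v) ∈ allEdges ρ := by
  have h3 : ρ u ≤ Finset.univ.sup ρ := Finset.le_sup (Finset.mem_univ u)
  simp only [allEdges, Finset.mem_filter, Finset.mem_product, Finset.mem_univ, Finset.mem_Icc,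
    true_and, and_true]
  exact ⟨⟨h1, h2.trans h3⟩, h1, h2⟩

theorem comp_reaches {V : Type*} [DecidableEq V] [Fintype V]
    [LinearOrder (V × ℕ × V)] {ρ : V → ℕ} (N : ℕ) : ∀ P : RegGraph V ρ × Param V,
    Set.ncard {e | e ∈ allEdges ρ ∧ e ∉ P.1.E} ≤ N →
    ∃ m : ℕ, Comp (Comp^[m] P) = Comp^[m] P ∧ Complete (Comp^[m] P).1 := by
  induction N with
  | zero =>
    intro P hP
    have hfin : Set.Finite {e | e ∈ allEdges ρ ∧ e ∉ P.1.E} :=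
      (allEdges ρ).finite_toSet.subset (fun e he => he.1)
    have h0 := (Set.ncard_eq_zero hfin).1 (Nat.le_zero.1 hP)
    have hc : ∀ e ∈ allEdges ρ, e ∈ P.1.E := by
      intro e he
      by_contra hne
      have : e ∈ {e | e ∈ allEdges ρ ∧ e ∉ P.1.E} := ⟨he, hne⟩
      rw [h0] at this
      exact this
    refine ⟨0, ?_, fun u v n h1 h2 => hc _ (mem_allEdges_of u v n h1 h2)⟩
    simp only [Function.iterate_zero, id]
    unfold Comp
    apply dif_neg
    rintro ⟨e, he⟩
    rw [Finset.mem_sdiff] at he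
    exact he.2 (hc e he.1)
  | succ N ih =>
    intro P hP
    have hfin : Set.Finite {e | e ∈ allEdges ρ ∧ e ∉ P.1.E} :=
      (allEdges ρ).finite_toSet.subset (fun e he => he.1)
    by_cases hc : ∀ e ∈ allEdges ρ, e ∈ P.1.E
    · apply ih P
      have : {e | e ∈ allEdges ρ ∧ e ∉ P.1.E} = ∅ := by
        ext e
        simp only [Set.mem_setOf_eq, Set.mem_empty_iff_false, iff_false, not_and, not_not]
        exact hc e
      rw [this]
      simp
    · have key : ∃ a, a ∈ allEdges ρ ∧ a ∉ P.1.E ∧ ∀ e, e ∈ (Comp P).1.E ↔ e = a ∨ e ∈ P.1.E := by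
        unfold Comp
        split_ifs with h
        · have hm := Finset.min'_mem _ h
          rw [Finset.mem_sdiff] at hm
          exact ⟨_, hm.1, hm.2, fun e => Finset.mem_insert⟩
        · exfalso
          push Not at hc
          obtain ⟨e, he, hne⟩ := hc
          exact h ⟨e, Finset.mem_sdiff.2 ⟨he, hne⟩⟩
      obtain ⟨a, ha, hna, hE⟩ := key
      have hlt : Set.ncard {e | e ∈ allEdges ρ ∧ e ∉ (Comp P).1.E} <
          Set.ncard {e | e ∈ allEdges ρ ∧ e ∉ P.1.E} := by
        apply Set.ncard_lt_ncard _ hfin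
        refine ⟨fun e he => ⟨he.1, fun h => he.2 ((hE e).2 (Or.inr h))⟩, fun hsub => ?_⟩
        exact (hsub ⟨ha, hna⟩ : a ∈ {e | e ∈ allEdges ρ ∧ e ∉ (Comp P).1.E}).2
          ((hE a).2 (Or.inl rfl))
      obtain ⟨m, hm⟩ := ih (Comp P) (by omega)
      exact ⟨m + 1, hm⟩

/-- The sequence of iterated completions becomes constant after
finitely many steps at a fixed point of `Comp`, whose graph is complete. -/
theorem completion_converges {V : Type*} [DecidableEq V] [Fintype V]
    [LinearOrder (V × ℕ × V)] {ρ : V → ℕ} (hρ : ∀ v, 1 ≤ ρ v)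
    (G : RegGraph V ρ) (K : Param V) (hK : IsParam G K) :
    ∃ m : ℕ, (∀ k : ℕ, m ≤ k → Comp^[k] (G, K) = Comp^[m] (G, K)) ∧
      Comp (Comp^[m] (G, K)) = Comp^[m] (G, K) ∧
      Complete (Comp^[m] (G, K)).1 := by
  obtain ⟨m, hfix, hcomp⟩ := comp_reaches _ (G, K) le_rfl
  refine ⟨m, ?_, hfix, hcomp⟩
  intro k hk
  induction k, hk using Nat.le_induction with
  | base => rfl
  | succ k hk ih => rw [Function.iterate_succ_apply', ih, hfix]

end MVReg
end

section
/- Let G=(V,E,ρ) be a multi-valued regulatory graph, K ∈ K_G, and (u,n,v) ∈ E an edge that is not observable in the parametrization K. Then (u,n,v) is not observable in the asynchronous transition system T_G(K). -/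
/-!
Formalization of multi-valued regulatory graphs (Thomas networks),
their parametrizations, asynchronous transition systems,
canonization, completion, normalization and minimization.
-/

namespace MVReg

open Classical

variable {V : Type*} [DecidableEq V] [Fintype V] {ρ : V → ℕ}

theorem aux_sSup {T : Set ℕ} {a : ℕ} (P : ℕ → Prop) (ha : a ∈ T) (hP : P a)
    (hub : ∀ m ∈ T, P m → m ≤ a) : sSup {m | m ∈ T ∧ P m} = a :=
  IsGreatest.csSup_eq ⟨⟨ha, hP⟩, fun m hm => hub m hm.1 hm.2⟩

theorem aux_sInf {T : Set ℕ} {a : ℕ} (P : ℕ → Prop) (ha : a ∈ T) (hP : P a)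
    (hlb : ∀ m ∈ T, P m → a ≤ m) : sInf {m | m ∈ T ∧ P m} = a :=
  IsLeast.csInf_eq ⟨⟨ha, hP⟩, fun m hm => hlb m hm.1 hm.2⟩

theorem aux_sSup_mem {T : Set ℕ} (x : ℕ) (P : ℕ → Prop) (hP : ∀ m, P m → m ≤ x)
    (h0 : 0 ∈ T) (hP0 : P 0) :
    sSup {m | m ∈ T ∧ P m} ∈ T ∧ P (sSup {m | m ∈ T ∧ P m}) ∧
      ∀ m ∈ T, P m → m ≤ sSup {m | m ∈ T ∧ P m} := by
  have hb : BddAbove {m | m ∈ T ∧ P m} := ⟨x, fun m hm => hP m hm.2⟩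
  have := Nat.sSup_mem (s := {m | m ∈ T ∧ P m}) ⟨0, h0, hP0⟩ hb
  exact ⟨this.1, this.2, fun m h1 h2 => le_csSup hb ⟨h1, h2⟩⟩

theorem aux_sInf_mem {T : Set ℕ} (P : ℕ → Prop) (b : ℕ) (hb : b ∈ T) (hPb : P b) :
    sInf {m | m ∈ T ∧ P m} ∈ T ∧ P (sInf {m | m ∈ T ∧ P m}) ∧
      ∀ m ∈ T, P m → sInf {m | m ∈ T ∧ P m} ≤ m := by
  have := Nat.sInf_mem (s := {m | m ∈ T ∧ P m}) ⟨b, hb, hPb⟩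
  exact ⟨this.1, this.2, fun m h1 h2 => Nat.sInf_le ⟨h1, h2⟩⟩

theorem aux_ctx_mem {V : Type*} {ρ : V → ℕ} (G : RegGraph V ρ) (v : V) (s : V → ℕ)
    (hs : s ∈ States ρ) : ctxOf G v s ∈ Context G v := by
  intro u
  have h1 := aux_sSup_mem (T := Theta G u v) (s u) (fun m => m ≤ s u) (fun _ h => h)
    (by simp [Theta]) (Nat.zero_le _)
  have h2 := aux_sInf_mem (T := Theta G u v) (fun m => s u < m) (ρ u + 1)
    (by simp [Theta]) (Nat.lt_succ_of_le (hs u))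
  refine ⟨h1.1, h2.1, lt_of_le_of_lt h1.2.1 h2.2.1, ?_⟩
  rintro l hl ⟨ha, hb⟩
  by_cases hc : l ≤ s u
  · exact absurd (h1.2.2 l hl hc) (not_le.mpr ha)
  · exact absurd (h2.2.2 l hl (not_le.mp hc)) (not_le.mpr hb)

theorem aux_delta {V : Type*} {ρ : V → ℕ} (G : RegGraph V ρ) (K : Param V) (v : V)
    (s : V → ℕ) : delta G K v s = Int.sign ((K v (ctxOf G v s) : ℤ) - (s v : ℤ)) := by
  unfold delta F
  rcases lt_trichotomy (s v) (K v (ctxOf G v s)) with h | h | h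
  · rw [if_pos h, Int.sign_eq_one_of_pos (by omega)]; push_cast; ring
  · rw [if_neg (by omega), if_pos h, ← h]; simp
  · rw [if_neg (by omega), if_neg (by omega), Int.sign_eq_neg_one_of_neg (by omega)]; omega

/-- An edge not observable in the parametrization `K` is not
observable in the asynchronous transition system `T_G(K)`. -/
theorem unobservable_param_unobservable_TS {V : Type*} [DecidableEq V] [Fintype V]
    {ρ : V → ℕ} (hρ : ∀ v, 1 ≤ ρ v) (G : RegGraph V ρ)
    (K : Param V) (hK : IsParam G K)
    (e : V × ℕ × V) (he : e ∈ G.E) (h : NotObsParam G K e) :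
    NotObsTS G K e := by
  obtain ⟨u, n, v⟩ := e
  intro s hs _ _
  have hn := G.valid _ he
  simp only at hn ⊢
  have hnT : n ∈ Theta G u v := Or.inl he
  have hm : nminus G u v n ∈ Theta G u v ∧ nminus G u v n < n ∧
      ∀ m ∈ Theta G u v, m < n → m ≤ nminus G u v n :=
    aux_sSup_mem (T := Theta G u v) n (fun m => m < n) (fun _ h => h.le)
      (by simp [Theta]) (by omega)
  have hp : nplus G u v n ∈ Theta G u v ∧ n < nplus G u v n ∧
      ∀ m ∈ Theta G u v, n < m → nplus G u v n ≤ m :=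
    aux_sInf_mem (T := Theta G u v) (fun m => n < m) (ρ u + 1) (by simp [Theta]) (by omega)
  have hhi : ∀ j, n ≤ j → j < nplus G u v n →
      ctxOf G v (Function.update s u j) u = (n, nplus G u v n) := by
    intro j h1 h2
    simp only [ctxOf, Function.update_self]
    rw [aux_sSup (fun m => m ≤ j) hnT h1, aux_sInf (fun m => j < m) hp.1 h2]
    · intro m hmT hlt; exact hp.2.2 m hmT (by omega)
    · intro m hmT hle
      by_contra hc
      have := hp.2.2 m hmT (by omega)
      omega
  have hlo : ∀ j, nminus G u v n ≤ j → j < n →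
      ctxOf G v (Function.update s u j) u = (nminus G u v n, n) := by
    intro j h1 h2
    simp only [ctxOf, Function.update_self]
    rw [aux_sSup (fun m => m ≤ j) hm.1 h1, aux_sInf (fun m => j < m) hnT h2]
    · intro m hmT hlt
      by_contra hc
      have := hm.2.2 m hmT (by omega)
      omega
    · intro m hmT hle; exact hm.2.2 m hmT (by omega)
  have hne : ∀ j w, w ≠ u → ctxOf G v (Function.update s u j) w = ctxOf G v s w := by
    intro j w hw
    simp only [ctxOf, Function.update_of_ne hw]
  have hst : Function.update s u n ∈ States ρ := by
    intro w
    by_cases hw : w = u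
    · subst hw; simpa using hn.2
    · rw [Function.update_of_ne hw]; exact hs w
  have hc := aux_ctx_mem G v _ hst
  refine ⟨K v (ctxOf G v (Function.update s u n)), hK v _ hc, ?_⟩
  intro j hj1 hj2
  rw [aux_delta]
  have key : K v (ctxOf G v (Function.update s u j)) =
      K v (ctxOf G v (Function.update s u n)) := by
    by_cases hjn : n ≤ j
    · congr 1
      funext w
      by_cases hw : w = u
      · subst hw; rw [hhi j hjn hj2, hhi n le_rfl hp.2.1]
      · rw [hne j w hw, hne n w hw]
    · have h2 := h _ hc (hhi n le_rfl hp.2.1)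
      simp only at h2
      rw [h2]
      congr 1
      funext w
      by_cases hw : w = u
      · subst hw; rw [hlo j hj1 (by omega), Function.update_self]
      · rw [Function.update_of_ne hw, hne j w hw, hne n w hw]
  rw [key]

end MVReg
end

section
/- The monotone target value is constant on regulatory contexts: for every multi-valued regulatory graph G, every parametrization K ∈ K_G, every component v∈V and every regulatory context ω∈Ω_v, we have (F^K_v)^mon(s) = (F^K_v)^mon(s') for all states s,s' ∈ ω. -/
/-!
Formalization of multi-valued regulatory graphs (Thomas networks),
their parametrizations, asynchronous transition systems,
canonization, completion, normalization and minimization.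
-/

namespace MVReg

open Classical

variable {V : Type*} [DecidableEq V] [Fintype V] {ρ : V → ℕ}

theorem ctxOf_eq_aux (G : RegGraph V ρ) (v u : V) (s : V → ℕ) (p : ℕ × ℕ)
    (hp : p ∈ ActInterval G u v) (h1 : p.1 ≤ s u) (h2 : s u < p.2) :
    ctxOf G v s u = p := by
  obtain ⟨ha, hb, hab, hl⟩ := hp
  refine Prod.ext ?_ ?_
  · refine IsGreatest.csSup_eq ⟨⟨ha, h1⟩, ?_⟩
    rintro m ⟨hm, hm'⟩
    by_contra hc
    exact hl m hm ⟨by omega, by omega⟩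
  · refine IsLeast.csInf_eq ⟨⟨hb, h2⟩, ?_⟩
    rintro m ⟨hm, hm'⟩
    by_contra hc
    exact hl m hm ⟨by omega, by omega⟩

/-- Abstract monotone target value. -/
noncomputable def monAux (d : ℕ → ℤ) (x : ℕ) : ℕ :=
  if d x = 0 then x
  else if d x = 1 then sInf {j | x < j ∧ d j ≠ 1}
  else sSup {j | j < x ∧ d j ≠ -1}

theorem monAux_step (d : ℕ → ℤ) (k x : ℕ)
    (h0 : d x = if x < k then 1 else if x = k then 0 else -1)
    (h1 : d (x+1) = if x + 1 < k then 1 else if x + 1 = k then 0 else -1) :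
    monAux d x = monAux d (x+1) := by
  rcases lt_trichotomy k x with h | h | h
  · have e0 : d x = -1 := by rw [h0, if_neg (by omega), if_neg (by omega)]
    have e1 : d (x+1) = -1 := by rw [h1, if_neg (by omega), if_neg (by omega)]
    simp only [monAux, e0, e1]
    norm_num
    congr 1
    ext j
    constructor
    · rintro ⟨a, b⟩
      exact ⟨by omega, b⟩
    · rintro ⟨a, b⟩
      refine ⟨?_, b⟩
      rcases Nat.lt_or_eq_of_le a with c | c
      · exact c
      · exact absurd (c ▸ e0) b
  · have e0 : d x = 0 := by rw [h0, if_neg (by omega), if_pos (by omega)]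
    have e1 : d (x+1) = -1 := by rw [h1, if_neg (by omega), if_neg (by omega)]
    simp only [monAux, e0, e1]
    norm_num
    symm
    refine IsGreatest.csSup_eq ⟨⟨by omega, by omega⟩, ?_⟩
    rintro m ⟨hm, -⟩
    omega
  · have e0 : d x = 1 := by rw [h0, if_pos (by omega)]
    by_cases hk : k = x + 1
    · have e1 : d (x+1) = 0 := by rw [h1, if_neg (by omega), if_pos (by omega)]
      simp only [monAux, e0, e1]
      norm_num
      refine IsLeast.csInf_eq ⟨⟨by omega, by omega⟩, ?_⟩
      rintro m ⟨hm, -⟩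
      omega
    · have e1 : d (x+1) = 1 := by rw [h1, if_pos (by omega)]
      simp only [monAux, e0, e1]
      norm_num
      congr 1
      ext j
      constructor
      · rintro ⟨a, b⟩
        refine ⟨?_, b⟩
        rcases Nat.lt_or_ge (x+1) j with c | c
        · exact c
        · have : j = x + 1 := by omega
          exact absurd (this ▸ e1) b
      · rintro ⟨a, b⟩
        exact ⟨by omega, b⟩

theorem monAux_const (d : ℕ → ℤ) (k a b : ℕ)
    (h : ∀ x, a ≤ x → x < b → d x = if x < k then 1 else if x = k then 0 else -1)
    (x y : ℕ) (hx : a ≤ x) (hxy : x ≤ y) (hy : y < b) :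
    monAux d x = monAux d y := by
  induction y, hxy using Nat.le_induction with
  | base => rfl
  | succ n hn ih =>
    rw [ih (by omega)]
    exact monAux_step d k n (h n (by omega) (by omega)) (h (n+1) (by omega) hy)

theorem mon_eq_monAux (G : RegGraph V ρ) (K : Param V) (v : V) (s : V → ℕ) :
    mon G K v s = monAux (fun j => delta G K v (Function.update s v j)) (s v) := by
  simp only [mon, monAux, Function.update_eq_self]

theorem delta_eq_aux (G : RegGraph V ρ) (K : Param V) (v : V) (s : V → ℕ) :
    delta G K v s = if s v < K v (ctxOf G v s) then 1
      else if s v = K v (ctxOf G v s) then 0 else -1 := by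
  unfold delta F
  split_ifs <;> omega

/-- The monotone target value is constant on every regulatory
context. -/
theorem mon_constant_on_context {V : Type*} [DecidableEq V] [Fintype V]
    {ρ : V → ℕ} (hρ : ∀ v, 1 ≤ ρ v) (G : RegGraph V ρ)
    (K : Param V) (hK : IsParam G K)
    (v : V) (ω : V → ℕ × ℕ) (hω : ω ∈ Context G v)
    (s s' : V → ℕ) (hs : s ∈ States ρ) (hs' : s' ∈ States ρ)
    (hmem : memCtx ω s) (hmem' : memCtx ω s') :
    mon G K v s = mon G K v s' := by
  have hctx : ∀ j, ctxOf G v (Function.update s v j) = ctxOf G v (Function.update s' v j) := by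
    intro j
    funext u
    by_cases hu : u = v
    · subst hu
      simp [ctxOf]
    · rw [ctxOf_eq_aux G v u _ (ω u) (hω u) (by simpa [hu] using (hmem u).1)
          (by simpa [hu] using (hmem u).2),
        ctxOf_eq_aux G v u _ (ω u) (hω u) (by simpa [hu] using (hmem' u).1)
          (by simpa [hu] using (hmem' u).2)]
  have hd : (fun j => delta G K v (Function.update s v j)) =
      (fun j => delta G K v (Function.update s' v j)) := by
    funext j
    rw [delta_eq_aux, delta_eq_aux, hctx j]
    simp
  have hk : ∀ x, (ω v).1 ≤ x → x < (ω v).2 →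
      (fun j => delta G K v (Function.update s' v j)) x =
        if x < K v ω then 1 else if x = K v ω then 0 else -1 := by
    intro x h1 h2
    have hc : ctxOf G v (Function.update s' v x) = ω := by
      funext u
      by_cases hu : u = v
      · subst hu
        exact ctxOf_eq_aux G u u _ (ω u) (hω u) (by simpa using h1) (by simpa using h2)
      · exact ctxOf_eq_aux G v u _ (ω u) (hω u) (by simpa [hu] using (hmem' u).1)
          (by simpa [hu] using (hmem' u).2)
    show delta G K v (Function.update s' v x) = _
    rw [delta_eq_aux, hc]
    simp
  rw [mon_eq_monAux, mon_eq_monAux, hd]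
  rcases le_total (s v) (s' v) with h | h
  · exact monAux_const _ _ _ _ hk _ _ (hmem v).1 h (hmem' v).2
  · exact (monAux_const _ _ _ _ hk _ _ (hmem' v).1 h (hmem v).2).symm

end MVReg
end
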